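/- Let k be an odd integer with 1 ≤ k ≤ n and let s be an integer with 0 ≤ 2s ≤ k−1; set m := k−2s. Define a* ∈ A_{2n} by a* := x_1 if m = 1, and otherwise a* := x_1·[x_2, x_3·[x_4, x_5·[⋯[x_{m−1}, x_m]⋯]]] (pairs (x_2,x_3), (x_4,x_5), …, (x_{m−1},x_m), nested as shown), and set X := Σ_{i=1}^{n} ([x_i, [a*, x_{i+n}]·ω^s] − [x_{i+n}, [a*, x_i]·ω^s]). Then for every l with 1 ≤ l ≤ 2n, the element ∂_l(X) lies in L_4(A_{2n}). -/

import Mathlib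

noncomputable section

/-- Lower central series: `lcs A 1 = A`, `lcs A (k+1) = [A, lcs A k]` (ℂ-linear span). -/
def lcs (A : Type) [Ring A] [Algebra ℂ A] : ℕ → Submodule ℂ A
  | 0 => ⊤
  | 1 => ⊤
  | (k+2) => Submodule.span ℂ {x | ∃ a : A, ∃ b ∈ lcs A (k+1), x = a * b - b * a}

/-- The free algebra on `2n` generators. -/
abbrev FA (n : ℕ) : Type := FreeAlgebra ℂ (Fin (2*n))

/-- The generator `x_j` (1-based indexing, junk value `0` out of range). -/
def X (n : ℕ) (j : ℕ) : FA n :=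
  if h : 1 ≤ j ∧ j ≤ 2*n then FreeAlgebra.ι ℂ (⟨j-1, by omega⟩ : Fin (2*n)) else 0

/-- `ω = (1/2) ∑ᵢ [xᵢ, xᵢ₊ₙ]`. -/
def omg (n : ℕ) : FA n :=
  (1/2 : ℂ) • ∑ i ∈ Finset.Icc 1 n, (X n i * X n (i+n) - X n (i+n) * X n i)


/-- The commutator `[a,b] = ab − ba`. -/
def com (n : ℕ) (a b : FA n) : FA n := a * b - b * a

/-- `wAux n m i = w_{(m−1−2i)}`, where `w_{(m−1)} := [x_{m−1}, x_m]` and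
`w_{(j)} := [x_j, x_{j+1}·w_{(j+2)}]` descending; so `w_{(2)} = wAux n m ((m-3)/2)`. -/
def wAux (n m : ℕ) : ℕ → FA n
  | 0 => com n (X n (m-1)) (X n m)
  | (i+1) => com n (X n (m-1-2*(i+1))) (X n (m-2*(i+1)) * wAux n m i)

section LowerCentralSeries

variable {A : Type} [Ring A] [Algebra ℂ A]

theorem commutator_mem_lcs (k : ℕ) (a : A) {b : A} (hb : b ∈ lcs A (k + 1)) :
    a * b - b * a ∈ lcs A (k + 2) :=
  Submodule.subset_span ⟨a, b, hb, rfl⟩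

theorem lcs_succ_le (k : ℕ) : lcs A (k + 2) ≤ lcs A (k + 1) := by
  induction k with
  | zero => exact le_top
  | succ k ih =>
    refine Submodule.span_le.2 ?_
    rintro _ ⟨a, b, hb, rfl⟩
    exact commutator_mem_lcs k a (ih hb)

/-- A function alternating in its first three and in its last two arguments
and satisfying the Jacobi identity in its last three arguments vanishes. -/
theorem eq_zero_of_alternating_of_jacobi {B V : Type} [AddCommGroup V] [Module ℂ V]
    (G : B → B → B → B → B → V)
    (h12 : ∀ x y a b c, G y x a b c = -G x y a b c)
    (h23 : ∀ x y a b c, G x a y b c = -G x y a b c)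
    (h45 : ∀ x y a b c, G x y a c b = -G x y a b c)
    (hJ : ∀ x y a b c, G x y a b c + G x y b c a + G x y c a b = 0)
    (x y a b c : B) : G x y a b c = 0 := by
  have rot : ∀ x y a b c, G y a x b c = G x y a b c := fun x y a b c => by
    rw [h23 y x a, h12 x y a, neg_neg]
  have opp : ∀ x y a b c, G x y a b c = G x b c y a := fun x y a b c => by
    have e1 := hJ x y a b c
    have e2 := hJ x a y b c
    have e3 := hJ x b c y a
    have e4 := hJ x c b y a
    rw [h23 x y a] at e2
    rw [h45 x b y c a, h23 x y b, neg_neg, h23 x a b] at e3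
    rw [h23 x b c, h23 x y c, h45 x c a y b, h23 x a c, neg_neg] at e4
    have key : (2 : ℂ) • (G x y a b c - G x b c y a) = 0 := by
      linear_combination (norm := module) e1 - e2 - e3 + e4
    simpa [sub_eq_zero] using key
  have opp' : ∀ x y a b c, G x y a b c = G a b c x y := fun x y a b c => by
    rw [rot a x y b c, opp]
  have key : (3 : ℂ) • G x y a b c = 0 := by
    have e := hJ x y a b c
    rw [opp' x y b c a, opp' x y c a b, rot b c a, rot a b c, ← opp' x y a b c] at e
    linear_combination (norm := module) e
  simpa using key

theorem commutator_mul_triple_commutator_mem_lcs (x y a b c : A) :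
    x * (y * (a * (b * c - c * b) - (b * c - c * b) * a))
      - (y * (a * (b * c - c * b) - (b * c - c * b) * a)) * x ∈ lcs A 4 := by
  have h2 : ∀ b c : A, b * c - c * b ∈ lcs A 2 := fun b c =>
    commutator_mem_lcs 0 b (b := c) Submodule.mem_top
  have h3 : ∀ a b c : A, a * (b * c - c * b) - (b * c - c * b) * a ∈ lcs A 3 := fun a b c =>
    commutator_mem_lcs 1 a (h2 b c)
  have h4 : ∀ (x : A) {u : A}, u ∈ lcs A 3 → x * u - u * x ∈ lcs A 4 := fun x _ hu =>
    commutator_mem_lcs 2 x hu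
  rw [← Submodule.Quotient.mk_eq_zero]
  refine eq_zero_of_alternating_of_jacobi (B := A) (V := A ⧸ lcs A 4)
    (fun x y a b c => Submodule.Quotient.mk
      (x * (y * (a * (b * c - c * b) - (b * c - c * b) * a))
        - (y * (a * (b * c - c * b) - (b * c - c * b) * a)) * x)) ?_ ?_ ?_ ?_ x y a b c
  · intro x y a b c
    rw [← Submodule.Quotient.mk_neg, Submodule.Quotient.eq]
    set u := a * (b * c - c * b) - (b * c - c * b) * a with hu
    have hu3 : u ∈ lcs A 3 := h3 a b c
    have e1 := h4 (x * y) hu3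
    have e2 := h4 y (lcs_succ_le 2 (h4 x hu3))
    convert add_mem e1 e2 using 1
    noncomm_ring
  · intro x y a b c
    rw [← Submodule.Quotient.mk_neg, Submodule.Quotient.eq]
    set v := b * c - c * b with hv
    have hv2 : v ∈ lcs A 2 := h2 b c
    have e1 := h4 x (commutator_mem_lcs 1 (y * a) hv2)
    have e2 := h4 x (lcs_succ_le 2 (h4 a (commutator_mem_lcs 1 y hv2)))
    convert add_mem e1 e2 using 1
    noncomm_ring
  · intro x y a b c
    rw [← Submodule.Quotient.mk_neg]
    congr 1
    noncomm_ring
  · intro x y a b c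
    rw [← Submodule.Quotient.mk_add, ← Submodule.Quotient.mk_add, ← Submodule.Quotient.mk_zero]
    congr 1
    noncomm_ring

theorem commutator_mul_mem_lcs_four (x y : A) {u : A} (hu : u ∈ lcs A 3) :
    x * (y * u) - (y * u) * x ∈ lcs A 4 := by
  let φ : A →ₗ[ℂ] A := (LinearMap.mulLeft ℂ x - LinearMap.mulRight ℂ x) ∘ₗ LinearMap.mulLeft ℂ y
  suffices h : lcs A 3 ≤ (lcs A 4).comap φ from h hu
  refine Submodule.span_le.2 ?_
  rintro _ ⟨a, v, hv, rfl⟩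
  let ψ : A →ₗ[ℂ] A := φ ∘ₗ (LinearMap.mulLeft ℂ a - LinearMap.mulRight ℂ a)
  suffices h : lcs A 2 ≤ (lcs A 4).comap ψ from h hv
  refine Submodule.span_le.2 ?_
  rintro _ ⟨b, c, -, rfl⟩
  exact commutator_mul_triple_commutator_mem_lcs x y a b c

variable (A) in
/-- The left ideal generated by `lcs A 3`; it is in fact two-sided. -/
def lcsThreeIdeal : Ideal A := Ideal.span (lcs A 3 : Set A)

theorem mem_lcsThreeIdeal {u : A} (hu : u ∈ lcs A 3) : u ∈ lcsThreeIdeal A :=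
  Ideal.subset_span hu

theorem mul_mem_right_lcsThreeIdeal {u : A} (hu : u ∈ lcsThreeIdeal A) (z : A) :
    u * z ∈ lcsThreeIdeal A := by
  induction hu using Submodule.span_induction with
  | mem u hu =>
    have h := sub_mem (Ideal.mul_mem_left _ z (mem_lcsThreeIdeal hu))
      (mem_lcsThreeIdeal (lcs_succ_le 2 (commutator_mem_lcs 2 z hu)))
    rwa [sub_sub_cancel] at h
  | zero => simp
  | add u v _ _ hu hv => rw [add_mul]; exact add_mem hu hv
  | smul a u _ hu => rw [smul_eq_mul, mul_assoc]; exact Ideal.mul_mem_left _ a hu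

theorem commutator_mem_lcs_four (x : A) {u : A} (hu : u ∈ lcsThreeIdeal A) :
    x * u - u * x ∈ lcs A 4 := by
  suffices h : ∀ y, x * (y * u) - (y * u) * x ∈ lcs A 4 by simpa using h 1
  induction hu using Submodule.span_induction with
  | mem u hu => exact fun y => commutator_mul_mem_lcs_four x y hu
  | zero => simp
  | add u v _ _ hu hv =>
    intro y
    convert add_mem (hu y) (hv y) using 1
    noncomm_ring
  | smul a u _ hu =>
    intro y
    simpa [mul_assoc] using hu (y * a)

theorem commutator_mem_lcsThreeIdeal {u : A} (hu : u ∈ lcsThreeIdeal A) (y : A) :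
    u * y - y * u ∈ lcsThreeIdeal A :=
  sub_mem (mul_mem_right_lcsThreeIdeal hu y) (Ideal.mul_mem_left _ y hu)

theorem commutator_mem_lcsThreeIdeal_of_mem_lcs_two {u : A} (hu : u ∈ lcs A 2) (y : A) :
    u * y - y * u ∈ lcsThreeIdeal A := by
  rw [← neg_sub]
  exact neg_mem (mem_lcsThreeIdeal (commutator_mem_lcs 1 y hu))

end LowerCentralSeries

theorem com_mem_lcs_two (n : ℕ) (a b : FA n) : com n a b ∈ lcs (FA n) 2 :=
  commutator_mem_lcs 0 a (b := b) Submodule.mem_top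

theorem wAux_mem_lcs_two (n m i : ℕ) : wAux n m i ∈ lcs (FA n) 2 := by
  cases i <;> exact com_mem_lcs_two n _ _

section Derivation

variable {n : ℕ} {D : FA n →ₗ[ℂ] FA n} (hD : ∀ a b : FA n, D (a * b) = D a * b + a * D b)
include hD

theorem map_com (a b : FA n) : D (com n a b) = com n (D a) b + com n a (D b) := by
  simp only [com, map_sub, hD]
  abel

variable (hX : ∀ j, D (X n j) = 0 ∨ D (X n j) = 1)
include hX

theorem map_com_X_left (j : ℕ) (a : FA n) : D (com n (X n j) a) = com n (X n j) (D a) := by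
  rw [map_com hD]
  rcases hX j with h | h <;> simp [h, com]

theorem map_com_X_right (a : FA n) (j : ℕ) : D (com n a (X n j)) = com n (D a) (X n j) := by
  rw [map_com hD]
  rcases hX j with h | h <;> simp [h, com]

theorem map_omg : D (omg n) = 0 := by
  rw [omg, map_smul, map_sum, Finset.sum_eq_zero, smul_zero]
  intro i _
  refine (map_com_X_left hD hX i (X n (i + n))).trans ?_
  rcases hX (i + n) with h | h <;> simp [h, com]

theorem map_omg_pow (s : ℕ) : D (omg n ^ s) = 0 := by
  induction s with
  | zero => simpa using hD 1 1
  | succ s ih => rw [pow_succ, hD, ih, map_omg hD hX, zero_mul, mul_zero, add_zero]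

theorem map_wAux_mem (m i : ℕ) : D (wAux n m i) ∈ lcsThreeIdeal (FA n) := by
  induction i with
  | zero =>
    rw [wAux, map_com_X_left hD hX]
    rcases hX m with h | h <;> simp [h, com]
  | succ i ih =>
    rw [wAux, map_com_X_left hD hX, hD]
    have h1 := neg_mem (commutator_mem_lcsThreeIdeal
      (Ideal.mul_mem_left _ (X n (m - 2 * (i + 1))) ih) (X n (m - 1 - 2 * (i + 1))))
    have h2 := neg_mem (commutator_mem_lcsThreeIdeal_of_mem_lcs_two
      (wAux_mem_lcs_two n m i) (X n (m - 1 - 2 * (i + 1))))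
    rw [neg_sub] at h1 h2
    rcases hX (m - 2 * (i + 1)) with h | h
    · rw [h, zero_mul, zero_add]
      exact h1
    · rw [h, one_mul]
      convert add_mem h2 h1 using 1
      simp only [com]
      noncomm_ring

theorem com_map_X_mul_wAux_mem (m i : ℕ) (j : ℕ) (y : FA n) :
    com n (D (X n j * wAux n m i)) y ∈ lcsThreeIdeal (FA n) := by
  rw [hD]
  have h1 := commutator_mem_lcsThreeIdeal
    (Ideal.mul_mem_left _ (X n j) (map_wAux_mem hD hX m i)) y
  have h2 := commutator_mem_lcsThreeIdeal_of_mem_lcs_two (wAux_mem_lcs_two n m i) y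
  rcases hX j with h | h
  · rw [h, zero_mul, zero_add]
    exact h1
  · rw [h, one_mul]
    convert add_mem h2 h1 using 1
    simp only [com]
    noncomm_ring

end Derivation

/-- For `k` odd with `1 ≤ k ≤ n`, `0 ≤ 2s ≤ k−1`, `m := k−2s`,
`a* := x_1` if `m = 1`, else `a* := x_1·[x_2, x_3·[⋯[x_{m−1}, x_m]⋯]]`, and
`X := ∑_{i=1}^{n} ([x_i, [a*, x_{i+n}]·ω^s] − [x_{i+n}, [a*, x_i]·ω^s])`:
for every `1 ≤ l ≤ 2n`, `∂_l(X) ∈ L₄(A_{2n})`, where `∂_l` is the unique ℂ-linear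
derivation of `A_{2n}` with `∂_l(x_j) = δ_{lj}`. -/
theorem stmt9 (n : ℕ) (hn : 1 ≤ n) (k s : ℕ) (hodd : Odd k)
    (hk1 : 1 ≤ k) (hkn : k ≤ n) (hs : 2*s ≤ k-1)
    (m : ℕ) (hm : m = k - 2*s)
    (astar : FA n)
    (hastar : astar = if m = 1 then X n 1 else X n 1 * wAux n m ((m-3)/2))
    (Z : FA n)
    (hZ : Z = ∑ i ∈ Finset.Icc 1 n,
      (com n (X n i) (com n astar (X n (i+n)) * (omg n)^s)
        - com n (X n (i+n)) (com n astar (X n i) * (omg n)^s)))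
    (l : ℕ) (hl1 : 1 ≤ l) (hl2 : l ≤ 2*n)
    (D : FA n →ₗ[ℂ] FA n)
    (hD : ∀ a b : FA n, D (a * b) = D a * b + a * D b)
    (hDgen : ∀ j : Fin (2*n), D (FreeAlgebra.ι ℂ j) = if (j : ℕ) = l - 1 then 1 else 0) :
    D Z ∈ lcs (FA n) 4 := by
  have hX : ∀ j, D (X n j) = 0 ∨ D (X n j) = 1 := by
    intro j
    unfold X
    split_ifs
    · rw [hDgen]
      split_ifs <;> simp
    · simp
  have hcom : ∀ y, com n (D astar) y ∈ lcsThreeIdeal (FA n) := by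
    intro y
    rw [hastar]
    split_ifs
    · rcases hX 1 with h | h <;> simp [h, com]
    · exact com_map_X_mul_wAux_mem hD hX m _ 1 y
  have hterm : ∀ i j, D (com n (X n i) (com n astar (X n j) * omg n ^ s)) ∈ lcs (FA n) 4 := by
    intro i j
    rw [map_com_X_left hD hX, hD, map_omg_pow hD hX, mul_zero, add_zero, map_com_X_right hD hX]
    exact commutator_mem_lcs_four _ (mul_mem_right_lcsThreeIdeal (hcom _) _)
  rw [hZ, map_sum]
  refine sum_mem fun i _ => ?_
  rw [map_sub]
  exact sub_mem (hterm _ _) (hterm _ _)
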